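/- Suppose (A1)–(A3) hold and S̄ > 0. If (σ_per, R_per) is a positive ω-time periodic solution of the evolutionary tumor problem (i.e. R_per(t + ω) = R_per(t) > 0 for all t ≥ 0), then every solution (σ, R) of the evolutionary tumor problem on [0,∞) with R(0) > 0 satisfies lim_{t→+∞} |R(t) − R_per(t)| = 0. In particular, any two positive ω-time periodic solutions have identical radius components. -/

import Mathlib

open MeasureTheory Set Filter Topology

/-- Heaviside function: `H s = 1` for `s > 0`, `H s = 0` for `s ≤ 0`. -/
noncomputable def Hside (s : ℝ) : ℝ := if 0 < s then 1 else 0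

/-- Assumption (A1)/(A2): `f ∈ C¹[0,∞)` is strictly increasing. -/
def C1StrictInc (f : ℝ → ℝ) : Prop :=
  ContDiffOn ℝ 1 f (Ici 0) ∧ StrictMonoOn f (Ici 0)

/-- Proliferation rate `S`: `S s = g s` if `s > σD`, `S s = -ν` otherwise. -/
noncomputable def Sfun (g : ℝ → ℝ) (σD ν s : ℝ) : ℝ := if σD < s then g s else -ν

/-- A solution of the stationary radial nutrient problem with boundary parameter
`σbar` and radius `R`: `σ` is continuous on `[0,R]`, differentiable on `(0,R]`
with derivative `σ'` there, satisfies
`r² σ'(r) = ∫₀^r l² f(σ l) H(σ l − σD) dl` on `(0,R]` (encoding the ODE together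
with `σ'(0) = 0`), and the Robin condition `σ'(R) + β (σ(R) − σbar) = 0`. -/
structure IsStationarySol (f : ℝ → ℝ) (β σD σbar R : ℝ) (σ σ' : ℝ → ℝ) : Prop where
  cont : ContinuousOn σ (Icc 0 R)
  deriv : ∀ r ∈ Ioc (0:ℝ) R, HasDerivWithinAt σ (σ' r) (Icc 0 R) r
  ode : ∀ r ∈ Ioc (0:ℝ) R,
    r ^ 2 * σ' r = ∫ l in (0:ℝ)..r, l ^ 2 * f (σ l) * Hside (σ l - σD)
  robin : σ' R + β * (σ R - σbar) = 0

/-- A solution of the evolutionary tumor problem on `[0,∞)`: `R` is positive and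
differentiable on `[0,∞)` with derivative `R'`, for each `t ≥ 0` the radial profile
`σ(·,t)` solves the stationary problem with parameters `φ t` and `R t`, and
`R(t)² R'(t) = ∫₀^{R(t)} S(σ(r,t)) r² dr` for `t > 0`. -/
structure IsEvolutionSol (f g : ℝ → ℝ) (β σD ν : ℝ) (φ : ℝ → ℝ)
    (σ : ℝ → ℝ → ℝ) (R R' : ℝ → ℝ) : Prop where
  pos : ∀ t ≥ (0:ℝ), 0 < R t
  stat : ∀ t ≥ (0:ℝ), ∃ σ', IsStationarySol f β σD (φ t) (R t) (fun r => σ r t) σ'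
  deriv : ∀ t ≥ (0:ℝ), HasDerivWithinAt R (R' t) (Ici 0) t
  ode : ∀ t > (0:ℝ), (R t) ^ 2 * R' t = ∫ r in (0:ℝ)..(R t), Sfun g σD ν (σ r t) * r ^ 2


noncomputable def Ff (f : ℝ → ℝ) (σD s : ℝ) : ℝ := f s * Hside (s - σD)

structure GoodF (f : ℝ → ℝ) (σD : ℝ) : Prop where
  nonneg : ∀ s, 0 ≤ Ff f σD s
  mono : Monotone (Ff f σD)

lemma Ff_of_le {f : ℝ → ℝ} {σD s : ℝ} (h : s ≤ σD) : Ff f σD s = 0 := by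
  unfold Ff Hside; rw [if_neg (by linarith)]; simp

lemma Ff_of_lt {f : ℝ → ℝ} {σD s : ℝ} (h : σD < s) : Ff f σD s = f s := by
  unfold Ff Hside; rw [if_pos (by linarith)]; simp

lemma goodF_of {f : ℝ → ℝ} {σD : ℝ} (hσD : 0 < σD) (hf : C1StrictInc f) (hf0 : f 0 = 0) :
    GoodF f σD ∧ ∀ s > σD, 0 < f s := by
  have hp : ∀ s > σD, 0 < f s := fun s hs => by
    have := hf.2 (show (0:ℝ) ∈ Ici 0 by simp) (show s ∈ Ici 0 by simp; linarith) (by linarith)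
    linarith
  have hn : ∀ s, 0 ≤ Ff f σD s := fun s => by
    rcases le_or_gt s σD with h | h
    · rw [Ff_of_le h]
    · rw [Ff_of_lt h]; exact (hp s h).le
  refine ⟨⟨hn, fun a b hab => ?_⟩, hp⟩
  rcases le_or_gt a σD with h | h
  · rw [Ff_of_le h]; exact hn b
  · rw [Ff_of_lt h, Ff_of_lt (by linarith)]
    exact hf.2.monotoneOn (by simp; linarith) (by simp; linarith) hab

lemma GoodF.smul {f : ℝ → ℝ} {σD : ℝ} (h : GoodF f σD) (c : ℝ) :
    GoodF (fun s => c ^ 2 * f s) σD := by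
  have : Ff (fun s => c ^ 2 * f s) σD = fun s => c ^ 2 * Ff f σD s := by
    ext s; unfold Ff; ring
  constructor
  · intro s; rw [this]; exact mul_nonneg (sq_nonneg c) (h.nonneg s)
  · rw [this]; exact h.mono.const_mul (sq_nonneg c)

namespace IsStationarySol
variable {f : ℝ → ℝ} {β σD σbar R : ℝ} {σ σ' : ℝ → ℝ}

lemma ode' (h : IsStationarySol f β σD σbar R σ σ') {r : ℝ} (hr : r ∈ Ioc (0:ℝ) R) :
    r ^ 2 * σ' r = ∫ l in (0:ℝ)..r, l ^ 2 * Ff f σD (σ l) := by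
  rw [h.ode r hr]; unfold Ff; simp only [mul_assoc]

lemma deriv_nonneg (h : IsStationarySol f β σD σbar R σ σ') (hF : GoodF f σD) {r : ℝ}
    (hr : r ∈ Ioc (0:ℝ) R) : 0 ≤ σ' r := by
  have h1 : 0 ≤ r ^ 2 * σ' r := by
    rw [h.ode' hr]
    exact intervalIntegral.integral_nonneg hr.1.le
      (fun l _ => mul_nonneg (sq_nonneg l) (hF.nonneg _))
  have h2 : 0 < r ^ 2 := pow_pos hr.1 2
  exact nonneg_of_mul_nonneg_right h1 h2

lemma hasDerivAt (h : IsStationarySol f β σD σbar R σ σ') {r : ℝ} (hr : r ∈ Ioo (0:ℝ) R) :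
    HasDerivAt σ (σ' r) r :=
  (h.deriv r ⟨hr.1, hr.2.le⟩).hasDerivAt (Icc_mem_nhds hr.1 hr.2)

lemma mono (h : IsStationarySol f β σD σbar R σ σ') (hF : GoodF f σD) :
    MonotoneOn σ (Icc 0 R) := by
  apply monotoneOn_of_deriv_nonneg (convex_Icc 0 R) h.cont
  · rw [interior_Icc]; exact fun r hr => (h.hasDerivAt hr).differentiableAt.differentiableWithinAt
  · rw [interior_Icc]; intro r hr
    rw [(h.hasDerivAt hr).deriv]; exact h.deriv_nonneg hF ⟨hr.1, hr.2.le⟩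

lemma intble (h : IsStationarySol f β σD σbar R σ σ') (hF : GoodF f σD) {a b : ℝ}
    (ha : 0 ≤ a) (hab : a ≤ b) (hb : b ≤ R) :
    IntervalIntegrable (fun l => Ff f σD (σ l)) volume a b := by
  apply MonotoneOn.intervalIntegrable
  rw [uIcc_of_le hab]
  intro x hx y hy hxy
  exact hF.mono (h.mono hF ⟨ha.trans hx.1, hx.2.trans hb⟩ ⟨ha.trans hy.1, hy.2.trans hb⟩ hxy)

lemma intble2 (h : IsStationarySol f β σD σbar R σ σ') (hF : GoodF f σD) {a b : ℝ}
    (ha : 0 ≤ a) (hab : a ≤ b) (hb : b ≤ R) {k : ℝ → ℝ} (hk : Continuous k) :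
    IntervalIntegrable (fun l => k l * Ff f σD (σ l)) volume a b :=
  (h.intble hF ha hab hb).continuousOn_mul hk.continuousOn

lemma le_bar (h : IsStationarySol f β σD σbar R σ σ') (hF : GoodF f σD) (hβ : 0 < β)
    (hR : 0 < R) {r : ℝ} (hr : r ∈ Icc (0:ℝ) R) : σ r ≤ σbar := by
  have h1 := h.deriv_nonneg hF (right_mem_Ioc.2 hR)
  have h2 := h.robin
  have h3 := h.mono hF hr (right_mem_Icc.2 hR.le) hr.2
  have : β * (σ R - σbar) ≤ 0 := by linarith
  have := nonpos_of_mul_nonpos_right this hβ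
  linarith

lemma end_gt (h : IsStationarySol f β σD σbar R σ σ') (hF : GoodF f σD) (hβ : 0 < β)
    (hR : 0 < R) (hb : σD < σbar) : σD < σ R := by
  by_contra hc
  push Not at hc
  have h1 := h.ode' (right_mem_Ioc.2 hR)
  have h2 : ∫ l in (0:ℝ)..R, l ^ 2 * Ff f σD (σ l) = ∫ l in (0:ℝ)..R, (0:ℝ) := by
    apply intervalIntegral.integral_congr
    intro l hl
    rw [uIcc_of_le hR.le] at hl
    have := h.mono hF hl (right_mem_Icc.2 hR.le) hl.2
    simp [Ff_of_le (f := f) (this.trans hc)]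
  rw [h2] at h1
  simp at h1
  have h3 := h.robin
  rcases h1 with h1 | h1
  · exact hR.ne' h1
  · rw [h1] at h3
    have : 0 < β * (σbar - σ R) := mul_pos hβ (by linarith)
    linarith

lemma ge_D (h : IsStationarySol f β σD σbar R σ σ') (hF : GoodF f σD) (hβ : 0 < β)
    (hR : 0 < R) (hb : σD < σbar) {r : ℝ} (hr : r ∈ Icc (0:ℝ) R) : σD ≤ σ r := by
  refine le_trans ?_ (h.mono hF (left_mem_Icc.2 hR.le) hr hr.1)
  by_contra hc
  push Not at hc
  have h1 := h.end_gt hF hβ hR hb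
  obtain ⟨z, hz, hzD⟩ := intermediate_value_Icc hR.le h.cont ⟨hc.le, h1.le⟩
  have hz0 : 0 < z := by
    rcases hz.1.eq_or_lt with e | e
    · rw [← e] at hzD; linarith
    · exact e
  have hd : ∀ y ∈ Ioo 0 z, σ' y = 0 := by
    intro y hy
    have h1 := h.ode' (r := y) ⟨hy.1, hy.2.le.trans hz.2⟩
    have h2 : ∫ l in (0:ℝ)..y, l ^ 2 * Ff f σD (σ l) = ∫ l in (0:ℝ)..y, (0:ℝ) := by
      apply intervalIntegral.integral_congr
      intro l hl
      rw [uIcc_of_le hy.1.le] at hl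
      have := h.mono hF (a := l) (b := z) ⟨hl.1, hl.2.trans (hy.2.le.trans hz.2)⟩ hz
        (hl.2.trans hy.2.le)
      simp [Ff_of_le (f := f) (this.trans hzD.le)]
    rw [h2] at h1
    simp at h1
    rcases h1 with h1 | h1
    · exact absurd h1 hy.1.ne'
    · exact h1
  obtain ⟨c, hc1, hc2⟩ := exists_hasDerivAt_eq_slope σ σ' hz0
    (h.cont.mono (Icc_subset_Icc_right hz.2)) (fun x hx => h.hasDerivAt ⟨hx.1, hx.2.trans_le hz.2⟩)
  rw [hd c hc1, hzD, eq_comm, div_eq_zero_iff] at hc2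
  rcases hc2 with h3 | h3 <;> linarith

end IsStationarySol

lemma shift_compare {f : ℝ → ℝ} {β σD σbar R₁ R₂ : ℝ} {σ₁ σ₁' σ₂ σ₂' : ℝ → ℝ}
    (hF : GoodF f σD) (hβ : 0 < β) (hR₁ : 0 < R₁) (hR : R₁ ≤ R₂)
    (h₁ : IsStationarySol f β σD σbar R₁ σ₁ σ₁') (h₂ : IsStationarySol f β σD σbar R₂ σ₂ σ₂') :
    ∀ r ∈ Icc 0 R₁, σ₂ (r + (R₂ - R₁)) ≤ σ₁ r := by
  set h := R₂ - R₁ with hh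
  have hh0 : 0 ≤ h := by linarith
  set w : ℝ → ℝ := fun r => σ₂ (r + h) - σ₁ r with hw
  have hwc : ContinuousOn w (Icc 0 R₁) := by
    apply ContinuousOn.sub _ h₁.cont
    apply h₂.cont.comp (by fun_prop)
    intro r hr
    exact ⟨by linarith [hr.1], by linarith [hr.2]⟩
  have hwd : ∀ r ∈ Ioc 0 R₁, HasDerivWithinAt w (σ₂' (r + h) - σ₁' r) (Icc 0 R₁) r := by
    intro r hr
    apply HasDerivWithinAt.sub _ (h₁.deriv r hr)
    have := (h₂.deriv (r + h) ⟨by linarith [hr.1], by linarith [hr.2]⟩).comp r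
      (((hasDerivAt_id r).add_const h).hasDerivWithinAt (s := Icc 0 R₁))
      (show MapsTo (fun r => r + h) (Icc 0 R₁) (Icc 0 R₂) from
        fun r hr => ⟨by linarith [hr.1], by linarith [hr.2]⟩)
    simpa [Function.comp_def] using this
  by_contra hcon
  push Not at hcon
  obtain ⟨r₁, hr₁, hr₁w⟩ := hcon
  obtain ⟨m, hm, hmax⟩ := isCompact_Icc.exists_isMaxOn ⟨r₁, hr₁⟩ hwc
  have hmpos : 0 < w m := lt_of_lt_of_le (by simp only [hw]; linarith) (hmax hr₁)
  -- the last maximum point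
  have hA : IsCompact (Icc 0 R₁ ∩ w ⁻¹' {w m}) :=
    isCompact_Icc.of_isClosed_subset
      (hwc.preimage_isClosed_of_isClosed isClosed_Icc isClosed_singleton) inter_subset_left
  obtain ⟨a, ⟨ha, hawm⟩, hamax⟩ := hA.exists_isGreatest ⟨m, hm, rfl⟩
  simp only [mem_preimage, mem_singleton_iff] at hawm
  have hapos : 0 < w a := by rw [hawm]; exact hmpos
  have hamx : ∀ x ∈ Icc 0 R₁, w x ≤ w a := fun x hx => by rw [hawm]; exact hmax hx
  set Φ₂ : ℝ → ℝ := fun s => ∫ l in (0:ℝ)..s, l ^ 2 * Ff f σD (σ₂ l) with hΦ₂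
  set Φ₁ : ℝ → ℝ := fun s => ∫ l in (0:ℝ)..s, l ^ 2 * Ff f σD (σ₁ l) with hΦ₁
  rcases ha.2.eq_or_lt with haR | haR
  · -- maximum at the boundary
    have hd := hwd R₁ ⟨hR₁, le_rfl⟩
    have e1 := h₁.robin
    have e2 := h₂.robin
    have e3 : R₁ + h = R₂ := by rw [hh]; ring
    have hneg : σ₂' (R₁ + h) - σ₁' R₁ < 0 := by
      rw [e3]
      have : 0 < β * w R₁ := mul_pos hβ (haR ▸ hapos)
      simp only [hw, e3] at this
      linarith
    have hloc : IsLocalMaxOn w (Icc 0 R₁) R₁ :=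
      Filter.eventually_of_mem self_mem_nhdsWithin (fun x hx => haR ▸ hamx x hx)
    have hcone : (-R₁ : ℝ) ∈ posTangentConeAt (Icc 0 R₁) R₁ := by
      have := sub_mem_posTangentConeAt_of_segment_subset (s := Icc 0 R₁) (x := R₁) (y := 0)
        (by rw [segment_symm, segment_eq_Icc hR₁.le])
      simpa using this
    have := hloc.hasFDerivWithinAt_nonpos hd.hasFDerivWithinAt hcone
    simp at this
    nlinarith
  · have hflux : Φ₁ a ≤ (a / (a + h)) ^ 2 * Φ₂ (a + h) := by
      rcases ha.1.eq_or_lt with ha0 | ha0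
      · rw [← ha0]; simp [hΦ₁]
      · have hloc : IsLocalMax w a :=
          Filter.eventually_of_mem (Icc_mem_nhds ha0 haR) hamx
        have hz := hloc.hasDerivAt_eq_zero ((hwd a ⟨ha0, ha.2⟩).hasDerivAt (Icc_mem_nhds ha0 haR))
        have e1 := h₁.ode' (r := a) ⟨ha0, ha.2⟩
        have e2 := h₂.ode' (r := a + h) ⟨by linarith, by linarith⟩
        simp only [hΦ₁, hΦ₂]
        rw [← e1, ← e2, sub_eq_zero.1 hz]
        have : a + h ≠ 0 := by linarith
        field_simp
        exact le_rfl
    -- near a, w is positive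
    have hev : ∃ b ∈ Ioc a R₁, ∀ x ∈ Icc a b, 0 < w x := by
      have := (hwc a ha).eventually (lt_mem_nhds hapos)
      obtain ⟨ε, hε, hε2⟩ := Metric.mem_nhdsWithin_iff.1 this
      refine ⟨min R₁ (a + ε / 2), ⟨lt_min haR (by linarith), min_le_left _ _⟩, fun x hx => ?_⟩
      apply hε2
      refine ⟨?_, ha.1.trans hx.1, hx.2.trans (min_le_left _ _)⟩
      rw [Metric.mem_ball, Real.dist_eq, abs_of_nonneg (by linarith [hx.1])]
      linarith [hx.2.trans (min_le_right _ _)]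
    obtain ⟨b, hb, hbpos⟩ := hev
    have hder : ∀ r ∈ Ioo a b, 0 ≤ σ₂' (r + h) - σ₁' r := by
      intro r hr
      have hr0 : 0 < r := ha.1.trans_lt hr.1
      have hrR : r ≤ R₁ := hr.2.le.trans hb.2
      have e1 := h₁.ode' (r := r) ⟨hr0, hrR⟩
      have e2 := h₂.ode' (r := r + h) ⟨by linarith, by linarith⟩
      have i1 : Φ₁ r = Φ₁ a + ∫ l in a..r, l ^ 2 * Ff f σD (σ₁ l) := by
        rw [intervalIntegral.integral_add_adjacent_intervals]
        · exact h₁.intble2 hF le_rfl ha.1 ha.2 (by fun_prop)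
        · exact h₁.intble2 hF ha.1 hr.1.le hrR (by fun_prop)
      have i2 : Φ₂ (r + h) = Φ₂ (a + h) + ∫ l in a..r, (l + h) ^ 2 * Ff f σD (σ₂ (l + h)) := by
        rw [intervalIntegral.integral_comp_add_right (fun l => l ^ 2 * Ff f σD (σ₂ l)) h,
          intervalIntegral.integral_add_adjacent_intervals]
        · exact h₂.intble2 hF le_rfl (by linarith [ha.1]) (by linarith) (by fun_prop)
        · exact h₂.intble2 hF (by linarith [ha.1]) (by linarith [hr.1]) (by linarith) (by fun_prop)
      have hint2 : IntervalIntegrable (fun l => (l + h) ^ 2 * Ff f σD (σ₂ (l + h))) volume a r := by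
        have := (h₂.intble2 hF (a := a + h) (b := r + h) (k := fun l => l ^ 2)
          (by linarith [ha.1]) (by linarith [hr.1]) (by linarith) (by fun_prop)).comp_add_right h
        simpa using this
      have hfr : a / (a + h) ≤ r / (r + h) := by
        rcases ha.1.eq_or_lt with ha0 | ha0
        · rw [← ha0]; simp; positivity
        · rw [div_le_div_iff₀ (by linarith) (by linarith)]; nlinarith [hr.1]
      have i3 : ∫ l in a..r, l ^ 2 * Ff f σD (σ₁ l) ≤
          ∫ l in a..r, (r / (r + h)) ^ 2 * ((l + h) ^ 2 * Ff f σD (σ₂ (l + h))) := by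
        apply intervalIntegral.integral_mono_on hr.1.le
          (h₁.intble2 hF ha.1 hr.1.le hrR (by fun_prop)) (hint2.const_mul _)
        intro l hl
        have hl0 : 0 ≤ l := ha.1.trans hl.1
        have k1 : Ff f σD (σ₁ l) ≤ Ff f σD (σ₂ (l + h)) := by
          apply hF.mono
          have := hbpos l ⟨hl.1, hl.2.trans hr.2.le⟩
          simp only [hw] at this; linarith
        have k2 : l ≤ r / (r + h) * (l + h) := by
          rw [div_mul_eq_mul_div, le_div_iff₀ (by linarith)]
          nlinarith [hl.2]
        have k3 : l ^ 2 ≤ (r / (r + h)) ^ 2 * (l + h) ^ 2 := by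
          rw [← mul_pow]; exact pow_le_pow_left₀ hl0 k2 2
        rw [← mul_assoc]
        exact mul_le_mul k3 k1 (hF.nonneg _) (by positivity)
      rw [intervalIntegral.integral_const_mul] at i3
      have hΦ2nn : 0 ≤ Φ₂ (a + h) := intervalIntegral.integral_nonneg (by linarith [ha.1])
        (fun l _ => mul_nonneg (sq_nonneg l) (hF.nonneg _))
      have k4 : (a / (a + h)) ^ 2 * Φ₂ (a + h) ≤ (r / (r + h)) ^ 2 * Φ₂ (a + h) := by
        apply mul_le_mul_of_nonneg_right _ hΦ2nn
        have : 0 ≤ a / (a + h) := div_nonneg ha.1 (by linarith [ha.1])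
        exact pow_le_pow_left₀ this hfr 2
      have k5 : Φ₁ r ≤ (r / (r + h)) ^ 2 * Φ₂ (r + h) := by
        rw [i1, i2, mul_add]; linarith
      have k6 : r ^ 2 * σ₁' r ≤ r ^ 2 * σ₂' (r + h) := by
        calc r ^ 2 * σ₁' r = Φ₁ r := e1
          _ ≤ _ := k5
          _ = r ^ 2 * σ₂' (r + h) := by
            simp only [hΦ₂]; rw [← e2]
            have : r + h ≠ 0 := by linarith
            field_simp
      have := le_of_mul_le_mul_left k6 (by positivity)
      linarith
    have hmono : MonotoneOn w (Icc a b) := by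
      apply monotoneOn_of_deriv_nonneg (convex_Icc a b)
        (hwc.mono (Icc_subset_Icc ha.1 hb.2))
      · rw [interior_Icc]
        intro r hr
        exact ((hwd r ⟨ha.1.trans_lt hr.1, hr.2.le.trans hb.2⟩).hasDerivAt
          (Icc_mem_nhds (ha.1.trans_lt hr.1) (hr.2.trans_le hb.2))).differentiableAt.differentiableWithinAt
      · rw [interior_Icc]
        intro r hr
        rw [((hwd r ⟨ha.1.trans_lt hr.1, hr.2.le.trans hb.2⟩).hasDerivAt
          (Icc_mem_nhds (ha.1.trans_lt hr.1) (hr.2.trans_le hb.2))).deriv]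
        exact hder r hr
    have hbI : b ∈ Icc 0 R₁ := ⟨ha.1.trans hb.1.le, hb.2⟩
    have h1 := hmono (left_mem_Icc.2 hb.1.le) (right_mem_Icc.2 hb.1.le) hb.1.le
    have h2 := hamx b hbI
    have h3 : b ≤ a := hamax ⟨hbI, by simp only [mem_preimage, mem_singleton_iff]; rw [← hawm]; exact le_antisymm h2 h1⟩
    linarith [hb.1]

lemma scaled_mono {f : ℝ → ℝ} {β σD σbar R₁ R₂ : ℝ} {σ₁ σ₁' σ₂ σ₂' : ℝ → ℝ}
    (hF : GoodF f σD) (hβ : 0 < β) (hR₁ : 0 < R₁) (hR : R₁ ≤ R₂)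
    (h₁ : IsStationarySol f β σD σbar R₁ σ₁ σ₁') (h₂ : IsStationarySol f β σD σbar R₂ σ₂ σ₂')
    {x : ℝ} (hx : x ∈ Icc (0:ℝ) 1) : σ₂ (R₂ * x) ≤ σ₁ (R₁ * x) := by
  have k1 : R₁ * x ∈ Icc 0 R₁ := ⟨mul_nonneg hR₁.le hx.1, by nlinarith [hx.2]⟩
  refine le_trans ?_ (shift_compare hF hβ hR₁ hR h₁ h₂ _ k1)
  have : R₂ * x ≤ R₁ * x + (R₂ - R₁) := by nlinarith [hx.2]
  exact h₂.mono hF ⟨by nlinarith [hx.1], by nlinarith [hx.2]⟩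
    ⟨by linarith [k1.1], by linarith [k1.2]⟩ this

lemma scale_stat {f : ℝ → ℝ} {β σD σbar R : ℝ} {σ σ' : ℝ → ℝ} (hR : 0 < R)
    (h : IsStationarySol f β σD σbar R σ σ') :
    IsStationarySol (fun s => R ^ 2 * f s) (β * R) σD σbar 1 (fun x => σ (R * x))
      (fun x => R * σ' (R * x)) := by
  have hmaps : MapsTo (fun x => R * x) (Icc 0 1) (Icc 0 R) :=
    fun x hx => ⟨mul_nonneg hR.le hx.1, by nlinarith [hx.2]⟩
  have hI : ∀ x ∈ Ioc (0:ℝ) 1, R * x ∈ Ioc 0 R :=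
    fun x hx => ⟨mul_pos hR hx.1, by nlinarith [hx.2]⟩
  refine ⟨h.cont.comp (by fun_prop) hmaps, fun x hx => ?_, fun x hx => ?_, ?_⟩
  · have := (h.deriv (R * x) (hI x hx)).comp x
      (((hasDerivAt_id x).const_mul R).hasDerivWithinAt (s := Icc 0 1)) hmaps
    simpa [Function.comp_def, mul_comm] using this
  · have e := h.ode (R * x) (hI x hx)
    have e2 := intervalIntegral.mul_integral_comp_mul_left (a := 0) (b := x)
      (f := fun l => l ^ 2 * f (σ l) * Hside (σ l - σD)) R
    rw [mul_zero, ← e] at e2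
    have e3 : ∫ l in (0:ℝ)..x, l ^ 2 * (R ^ 2 * f (σ (R * l))) * Hside (σ (R * l) - σD)
      = ∫ l in (0:ℝ)..x, (R * l) ^ 2 * f (σ (R * l)) * Hside (σ (R * l) - σD) := by
      congr 1; ext l; ring
    rw [e3]
    apply mul_left_cancel₀ hR.ne'
    rw [e2]; ring
  · have := h.robin
    simp only [mul_one]
    linear_combination R * this


lemma Ff_smul {f : ℝ → ℝ} {σD c s : ℝ} : Ff (fun s => c ^ 2 * f s) σD s = c ^ 2 * Ff f σD s := by
  unfold Ff; ring

lemma ae_exists_mem {P : ℝ → Prop} (h : ∀ᵐ x, P x) {U : Set ℝ} (hU : IsOpen U)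
    (hne : U.Nonempty) : ∃ x ∈ U, P x := by
  obtain ⟨x, h1, h2⟩ := (MeasureTheory.Measure.dense_of_ae h).exists_mem_open hU hne
  exact ⟨x, h2, h1⟩

lemma intble_mono {Q u : ℝ → ℝ} (hQ : Monotone Q) (hu : MonotoneOn u (Icc 0 1)) :
    IntervalIntegrable (fun x => x ^ 2 * Q (u x)) volume 0 1 := by
  have : IntervalIntegrable (fun x => Q (u x)) volume 0 1 := by
    apply MonotoneOn.intervalIntegrable
    rw [uIcc_of_le zero_le_one]
    exact fun x hx y hy hxy => hQ (hu hx hy hxy)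
  exact this.continuousOn_mul (by fun_prop)

namespace IsStationarySol
variable {f : ℝ → ℝ} {β σD σbar R : ℝ} {σ σ' : ℝ → ℝ}

lemma flux_lower (h : IsStationarySol f β σD σbar R σ σ') (hF : GoodF f σD) {x y ζ : ℝ}
    (hx : 0 < x) (hxy : x ≤ y) (hy : y ≤ ζ) (hζ : ζ ≤ R) :
    x ^ 2 * (y - x) * Ff f σD (σ x) ≤ ∫ l in (0:ℝ)..ζ, l ^ 2 * Ff f σD (σ l) := by
  have hnn : ∀ l, 0 ≤ l ^ 2 * Ff f σD (σ l) := fun l => mul_nonneg (sq_nonneg l) (hF.nonneg _)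
  have i1 : ∫ l in (0:ℝ)..ζ, l ^ 2 * Ff f σD (σ l) =
      (∫ l in (0:ℝ)..x, l ^ 2 * Ff f σD (σ l)) + (∫ l in x..y, l ^ 2 * Ff f σD (σ l))
       + ∫ l in y..ζ, l ^ 2 * Ff f σD (σ l) := by
    rw [intervalIntegral.integral_add_adjacent_intervals,
      intervalIntegral.integral_add_adjacent_intervals]
    · exact h.intble2 hF le_rfl (by linarith) (by linarith) (by fun_prop)
    · exact h.intble2 hF (by linarith) (by linarith) (by linarith) (by fun_prop)
    · exact h.intble2 hF (by linarith) (by linarith) (by linarith) (by fun_prop)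
    · exact h.intble2 hF (by linarith) (by linarith) (by linarith) (by fun_prop)
  have i2 : ∫ l in x..y, x ^ 2 * Ff f σD (σ x) ≤ ∫ l in x..y, l ^ 2 * Ff f σD (σ l) := by
    apply intervalIntegral.integral_mono_on hxy (by simp)
      (h.intble2 hF (by linarith) (by linarith) (by linarith) (by fun_prop))
    intro l hl
    apply mul_le_mul (pow_le_pow_left₀ hx.le hl.1 2) _ (hF.nonneg _) (sq_nonneg _)
    exact hF.mono (h.mono hF ⟨hx.le, by linarith⟩ ⟨by linarith [hl.1], by linarith [hl.2]⟩ hl.1)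
  simp only [intervalIntegral.integral_const, smul_eq_mul] at i2
  have i3 : 0 ≤ ∫ l in (0:ℝ)..x, l ^ 2 * Ff f σD (σ l) :=
    intervalIntegral.integral_nonneg hx.le (fun l _ => hnn l)
  have i4 : 0 ≤ ∫ l in y..ζ, l ^ 2 * Ff f σD (σ l) :=
    intervalIntegral.integral_nonneg hy (fun l _ => hnn l)
  rw [i1]; nlinarith

lemma core_bound (h : IsStationarySol f β σD σbar 1 σ σ') (hF : GoodF f σD) {x y z : ℝ}
    (hx : 0 < x) (hxy : x < y) (hyz : y < z) (hz : z ≤ 1) :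
    x ^ 2 * (y - x) * (z - y) * Ff f σD (σ x) ≤ σ z - σ y := by
  obtain ⟨c, hc, hc2⟩ := exists_hasDerivAt_eq_slope σ σ' hyz
    (h.cont.mono (Icc_subset_Icc (by linarith) hz))
    (fun t ht => h.hasDerivAt ⟨by linarith [ht.1], by linarith [ht.2]⟩)
  have hcI : c ∈ Ioc (0:ℝ) 1 := ⟨by linarith [hc.1], by linarith [hc.2]⟩
  have h1 := h.flux_lower hF hx hxy.le hc.1.le hcI.2
  rw [← h.ode' hcI] at h1
  have h2 := h.deriv_nonneg hF hcI
  have h3 : c ^ 2 * σ' c ≤ σ' c := by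
    have : c ^ 2 ≤ 1 := pow_le_one₀ hcI.1.le hcI.2
    nlinarith
  rw [eq_div_iff (by linarith)] at hc2
  rw [← hc2]
  have : 0 < z - y := by linarith
  nlinarith

lemma lip (h : IsStationarySol f β σD σbar 1 σ σ') (hF : GoodF f σD) (hβ : 0 < β) {x : ℝ}
    (hx : x ∈ Ioo (0:ℝ) 1) : σ 1 - σ x ≤ Ff f σD σbar * (1 - x) := by
  obtain ⟨c, hc, hc2⟩ := exists_hasDerivAt_eq_slope σ σ' hx.2
    (h.cont.mono (Icc_subset_Icc hx.1.le le_rfl))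
    (fun t ht => h.hasDerivAt ⟨by linarith [ht.1, hx.1], by linarith [ht.2]⟩)
  have hcI : c ∈ Ioc (0:ℝ) 1 := ⟨by linarith [hc.1, hx.1], by linarith [hc.2]⟩
  have h1 := h.ode' hcI
  have h2 : ∫ l in (0:ℝ)..c, l ^ 2 * Ff f σD (σ l) ≤ ∫ l in (0:ℝ)..c, c ^ 2 * Ff f σD σbar := by
    apply intervalIntegral.integral_mono_on hcI.1.le
      (h.intble2 hF le_rfl hcI.1.le hcI.2 (by fun_prop)) (by simp)
    intro l hl
    apply mul_le_mul (pow_le_pow_left₀ hl.1 hl.2 2) _ (hF.nonneg _) (sq_nonneg _)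
    exact hF.mono (h.le_bar hF hβ one_pos ⟨hl.1, hl.2.trans hcI.2⟩)
  rw [← h1] at h2
  simp only [intervalIntegral.integral_const, smul_eq_mul, sub_zero] at h2
  have h3 : σ' c ≤ Ff f σD σbar := by
    have hp : 0 < c ^ 2 := pow_pos hcI.1 2
    have h4 : c ^ 2 * σ' c ≤ c ^ 2 * Ff f σD σbar := by
      refine h2.trans ?_
      have := mul_nonneg hp.le (hF.nonneg σbar)
      nlinarith [hcI.2]
    exact le_of_mul_le_mul_left h4 hp
  rw [eq_div_iff (by linarith [hx.2])] at hc2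
  rw [← hc2]
  exact mul_le_mul_of_nonneg_right h3 (by linarith [hx.2])

end IsStationarySol

lemma key_limit {f : ℝ → ℝ} {β σD σbar R₀ Rs : ℝ} (hF : GoodF f σD) (hfc : ContinuousOn f (Ici 0))
    (hfp : ∀ s > σD, 0 < f s) (hσD : 0 < σD) (hβ : 0 < β) (hb : σD < σbar)
    (hR₀ : 0 < R₀) (hRs : 0 < Rs) {Rn : ℕ → ℝ} (hRn : ∀ n, 0 < Rn n)
    (hlim : Tendsto Rn atTop (𝓝 Rs)) {u₀ u₀' : ℝ → ℝ} {u u' : ℕ → ℝ → ℝ}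
    (h₀ : IsStationarySol (fun s => R₀ ^ 2 * f s) (β * R₀) σD σbar 1 u₀ u₀')
    (hn : ∀ n, IsStationarySol (fun s => (Rn n) ^ 2 * f s) (β * Rn n) σD σbar 1 (u n) (u' n))
    (hae : ∀ᵐ x, x ∈ Ioo (0:ℝ) 1 → Tendsto (fun n => u n x) atTop (𝓝 (u₀ x))) : Rs = R₀ := by
  have hF₀ := hF.smul R₀
  have hFn := fun n => hF.smul (Rn n)
  have hβ₀ := mul_pos hβ hR₀
  have hβn := fun n => mul_pos hβ (hRn n)
  have hI : ∀ {x : ℝ}, x ∈ Ioo (0:ℝ) 1 → x ∈ Icc (0:ℝ) 1 := fun hx => ⟨hx.1.le, hx.2.le⟩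
  have hge := fun n {x} (hx : x ∈ Icc (0:ℝ) 1) => (hn n).ge_D (hFn n) (hβn n) one_pos hb hx
  have hle := fun n {x} (hx : x ∈ Icc (0:ℝ) 1) => (hn n).le_bar (hFn n) (hβn n) one_pos hx
  have hge0 := fun {x} (hx : x ∈ Icc (0:ℝ) 1) => h₀.ge_D hF₀ hβ₀ one_pos hb hx
  have hm0 := h₀.mono hF₀
  -- a.e. convergence of F
  have P1 : ∀ᵐ x, x ∈ Ioo (0:ℝ) 1 →
      Tendsto (fun n => Ff f σD (u n x)) atTop (𝓝 (Ff f σD (u₀ x))) := by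
    set X : Set ℝ := {x | x ∈ Ioo (0:ℝ) 1 ∧ u₀ x ≤ σD ∧ ∀ z ∈ Ioo (0:ℝ) 1, x < z → σD < u₀ z}
    have hX : X.Subsingleton := by
      intro a ha b hb
      by_contra hne
      rcases lt_or_gt_of_ne hne with hl | hl
      · exact absurd (ha.2.2 b hb.1 hl) (not_lt.2 hb.2.1)
      · exact absurd (hb.2.2 a ha.1 hl) (not_lt.2 ha.2.1)
    have hX0 : ∀ᵐ x, x ∉ X := measure_eq_zero_iff_ae_notMem.1 (hX.measure_zero volume)
    filter_upwards [hae, hX0] with x hx hxX hxI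
    rcases lt_or_ge σD (u₀ x) with hc | hc
    · rw [Ff_of_lt hc]
      have hca : ContinuousAt f (u₀ x) := hfc.continuousAt (Ici_mem_nhds (by linarith))
      refine (hca.tendsto.comp (hx hxI)).congr' ?_
      filter_upwards [(hx hxI).eventually (lt_mem_nhds hc)] with n hn'
      simp [Ff_of_lt hn']
    · rw [Ff_of_le hc]
      have : ∃ z ∈ Ioo (0:ℝ) 1, x < z ∧ u₀ z ≤ σD := by
        by_contra hcon
        push Not at hcon
        exact hxX ⟨hxI, hc, hcon⟩
      obtain ⟨z, hz, hxz, hzD⟩ := this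
      obtain ⟨z', hz', hz'lim⟩ := ae_exists_mem hae isOpen_Ioo (nonempty_Ioo.2 hxz)
      have hz'I : z' ∈ Ioo (0:ℝ) 1 := ⟨hxI.1.trans hz'.1, hz'.2.trans hz.2⟩
      have hz'D : u₀ z' = σD :=
        le_antisymm ((hm0 (hI hz'I) (hI hz) hz'.2.le).trans hzD) (hge0 (hI hz'I))
      have hlz := hz'lim hz'I
      rw [hz'D] at hlz
      obtain ⟨y, hxy, hyz⟩ := exists_between hz'.1
      have hc0 : 0 < x ^ 2 * (y - x) * (z' - y) :=
        mul_pos (mul_pos (pow_pos hxI.1 2) (by linarith)) (by linarith)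
      have hup : Tendsto (fun n => (u n z' - σD) / (x ^ 2 * (y - x) * (z' - y) * (Rn n) ^ 2)) atTop
          (𝓝 ((σD - σD) / (x ^ 2 * (y - x) * (z' - y) * Rs ^ 2))) :=
        (hlz.sub_const _).div ((hlim.pow 2).const_mul _) (by positivity)
      rw [sub_self, zero_div] at hup
      refine squeeze_zero (fun n => hF.nonneg _) (fun n => ?_) hup
      have := (hn n).core_bound (hFn n) hxI.1 hxy hyz hz'I.2.le
      rw [Ff_smul] at this
      have h3 := hge n (x := y) ⟨by linarith [hxI.1], by linarith [hz'I.2]⟩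
      have := hRn n
      rw [le_div_iff₀ (by positivity)]
      linarith
  set K := ∫ l in (0:ℝ)..1, l ^ 2 * Ff f σD (u₀ l) with hK
  have P2 : Tendsto (fun n => ∫ l in (0:ℝ)..1, l ^ 2 * Ff f σD (u n l)) atTop (𝓝 K) := by
    apply intervalIntegral.tendsto_integral_filter_of_dominated_convergence
      (fun _ => Ff f σD σbar)
    · refine Eventually.of_forall fun n => ?_
      rw [uIoc_of_le zero_le_one]
      exact (intble_mono hF.mono ((hn n).mono (hFn n))).1.aestronglyMeasurable
    · refine Eventually.of_forall fun n => Eventually.of_forall fun x hx => ?_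
      rw [uIoc_of_le zero_le_one] at hx
      rw [Real.norm_of_nonneg (mul_nonneg (sq_nonneg x) (hF.nonneg _))]
      have h1 : x ^ 2 ≤ 1 := pow_le_one₀ hx.1.le hx.2
      have h2 := hF.mono (hle n (x := x) ⟨hx.1.le, hx.2⟩)
      have h3 := hF.nonneg (u n x)
      nlinarith
    · simp
    · have h1 : ∀ᵐ x : ℝ, x ≠ 1 := Measure.ae_ne volume 1
      filter_upwards [P1, h1] with x hx hx1 hxI
      rw [uIoc_of_le zero_le_one] at hxI
      exact (hx ⟨hxI.1, lt_of_le_of_ne hxI.2 hx1⟩).const_mul _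
  have hend : ∀ {r : ℝ} {v v' : ℝ → ℝ}, 0 < r →
      IsStationarySol (fun s => r ^ 2 * f s) (β * r) σD σbar 1 v v' →
      v 1 = σbar - r / β * ∫ l in (0:ℝ)..1, l ^ 2 * Ff f σD (v l) := by
    intro r v v' hr hv
    have e1 := hv.ode' (right_mem_Ioc.2 one_pos)
    have e2 := hv.robin
    simp only [Ff_smul] at e1
    have e3 : ∫ l in (0:ℝ)..1, l ^ 2 * (r ^ 2 * Ff f σD (v l)) =
        r ^ 2 * ∫ l in (0:ℝ)..1, l ^ 2 * Ff f σD (v l) := by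
      rw [← intervalIntegral.integral_const_mul]; congr 1; ext l; ring
    rw [e3, one_pow, one_mul] at e1
    rw [e1] at e2
    field_simp
    apply mul_left_cancel₀ hr.ne'
    linear_combination e2
  have P3 : Tendsto (fun n => u n 1) atTop (𝓝 (σbar - Rs / β * K)) := by
    have : Tendsto (fun n => σbar - Rn n / β * ∫ l in (0:ℝ)..1, l ^ 2 * Ff f σD (u n l)) atTop
        (𝓝 (σbar - Rs / β * K)) := ((hlim.div_const β).mul P2).const_sub σbar
    exact this.congr (fun n => (hend (hRn n) (hn n)).symm)
  set Lm := σbar - Rs / β * K with hLm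
  have P4 : Lm = u₀ 1 := by
    apply le_antisymm
    · by_contra hcon
      push Not at hcon
      set C := Rs ^ 2 * Ff f σD σbar
      have hC : 0 ≤ C := mul_nonneg (sq_nonneg _) (hF.nonneg _)
      have hlt : max 0 (1 - (Lm - u₀ 1) / (C + 1)) < 1 := by
        apply max_lt one_pos
        have : 0 < (Lm - u₀ 1) / (C + 1) := div_pos (by linarith) (by linarith)
        linarith
      obtain ⟨x, hx, hxl⟩ := ae_exists_mem hae isOpen_Ioo (nonempty_Ioo.2 hlt)
      have hxI : x ∈ Ioo (0:ℝ) 1 := ⟨(le_max_left _ _).trans_lt hx.1, hx.2⟩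
      have h1 : Lm ≤ u₀ x + C * (1 - x) := by
        have hr : Tendsto (fun n => u n x + (Rn n) ^ 2 * Ff f σD σbar * (1 - x)) atTop
            (𝓝 (u₀ x + C * (1 - x))) :=
          (hxl hxI).add ((((hlim.pow 2).mul_const _)).mul_const _)
        refine le_of_tendsto_of_tendsto' P3 hr (fun n => ?_)
        have := (hn n).lip (hFn n) (hβn n) hxI
        rw [Ff_smul] at this
        linarith
      have h2 := hm0 (hI hxI) (right_mem_Icc.2 zero_le_one) hxI.2.le
      have h3 : 1 - (Lm - u₀ 1) / (C + 1) < x := (le_max_right _ _).trans_lt hx.1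
      have h4 : 1 - x < (Lm - u₀ 1) / (C + 1) := by linarith
      rw [lt_div_iff₀ (by linarith)] at h4
      nlinarith [hx.2]
    · by_contra hcon
      push Not at hcon
      have := (h₀.cont 1 (right_mem_Icc.2 zero_le_one)).eventually (lt_mem_nhds hcon)
      obtain ⟨ε, hε, hε2⟩ := Metric.mem_nhdsWithin_iff.1 this
      have hlt : max 0 (1 - ε) < 1 := max_lt one_pos (by linarith)
      obtain ⟨x, hx, hxl⟩ := ae_exists_mem hae isOpen_Ioo (nonempty_Ioo.2 hlt)
      have hxI : x ∈ Ioo (0:ℝ) 1 := ⟨(le_max_left _ _).trans_lt hx.1, hx.2⟩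
      have h1 : u₀ x ≤ Lm := le_of_tendsto_of_tendsto' (hxl hxI) P3
        (fun n => (hn n).mono (hFn n) (hI hxI) (right_mem_Icc.2 zero_le_one) hxI.2.le)
      have h2 : Lm < u₀ x := by
        apply hε2
        refine ⟨?_, hI hxI⟩
        rw [Metric.mem_ball, Real.dist_eq, abs_sub_comm, abs_of_nonneg (by linarith [hx.2])]
        linarith [(le_max_right 0 (1 - ε)).trans_lt hx.1]
      linarith
  have P5 : 0 < K := by
    have h1 := h₀.end_gt hF₀ hβ₀ one_pos hb
    have := (h₀.cont 1 (right_mem_Icc.2 zero_le_one)).eventually (lt_mem_nhds h1)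
    obtain ⟨ε, hε, hε2⟩ := Metric.mem_nhdsWithin_iff.1 this
    have hlt : max 0 (1 - ε) < 1 := max_lt one_pos (by linarith)
    obtain ⟨x, hx1, hx2⟩ := exists_between hlt
    have hx0 : 0 < x := (le_max_left _ _).trans_lt hx1
    have h2 : σD < u₀ x := by
      apply hε2
      refine ⟨?_, hx0.le, hx2.le⟩
      rw [Metric.mem_ball, Real.dist_eq, abs_sub_comm, abs_of_nonneg (by linarith)]
      linarith [(le_max_right 0 (1 - ε)).trans_lt hx1]
    have h3 := h₀.flux_lower hF₀ hx0 hx2.le le_rfl le_rfl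
    simp only [Ff_smul] at h3
    have e3 : ∫ l in (0:ℝ)..1, l ^ 2 * (R₀ ^ 2 * Ff f σD (u₀ l)) = R₀ ^ 2 * K := by
      rw [hK, ← intervalIntegral.integral_const_mul]; congr 1; ext l; ring
    rw [e3, Ff_of_lt h2] at h3
    have h4 : 0 < x ^ 2 * (1 - x) * (R₀ ^ 2 * f (u₀ x)) :=
      mul_pos (mul_pos (pow_pos hx0 2) (by linarith)) (mul_pos (pow_pos hR₀ 2) (hfp _ h2))
    exact pos_of_mul_pos_right (h4.trans_le h3) (by positivity)
  have e := hend hR₀ h₀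
  rw [← hK, ← P4, hLm] at e
  have : Rs / β * K = R₀ / β * K := by linarith
  have := mul_right_cancel₀ P5.ne' this
  field_simp at this
  exact this

lemma Sfun_mono {g : ℝ → ℝ} {σD ν : ℝ} (hσD : 0 < σD) (hg : C1StrictInc g)
    (hgν : 0 ≤ g σD + ν) :
    Monotone (Sfun g σD ν) ∧ StrictMonoOn (Sfun g σD ν) (Ici σD) := by
  have key : ∀ a b, σD < b → a < b → Sfun g σD ν a < Sfun g σD ν b := by
    intro a b hb hab
    unfold Sfun
    rw [if_pos hb]
    split_ifs with ha
    · exact hg.2 (show a ∈ Ici 0 by simp; linarith) (show b ∈ Ici 0 by simp; linarith) hab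
    · have := hg.2 (show σD ∈ Ici 0 by simp; linarith) (show b ∈ Ici 0 by simp; linarith) hb
      linarith
  constructor
  · intro a b hab
    rcases hab.eq_or_lt with h | h
    · rw [h]
    rcases lt_or_ge σD b with hb | hb
    · exact (key a b hb h).le
    · unfold Sfun; rw [if_neg (by linarith), if_neg (by linarith)]
  · intro a ha b hb hab
    exact key a b (lt_of_le_of_lt ha hab) hab

lemma tendsto_of_S {S : ℝ → ℝ} {σD b : ℝ} (hS : StrictMonoOn S (Ici σD)) {a : ℕ → ℝ}
    (ha : ∀ n, σD ≤ a n) (hb : σD ≤ b) (h : Tendsto (fun n => S (a n)) atTop (𝓝 (S b))) :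
    Tendsto a atTop (𝓝 b) := by
  rw [tendsto_order]
  constructor
  · intro c hc
    rcases lt_or_ge c σD with h1 | h1
    · exact Eventually.of_forall fun n => h1.trans_le (ha n)
    · filter_upwards [h.eventually (lt_mem_nhds (hS h1 hb hc))] with n hn
      exact (hS.lt_iff_lt h1 (ha n)).1 hn
  · intro c hc
    filter_upwards [h.eventually (gt_mem_nhds (hS hb (hb.trans hc.le) hc))] with n hn
    exact (hS.lt_iff_lt (ha n) (show c ∈ Ici σD from hb.trans hc.le)).1 hn


noncomputable def Gv (g : ℝ → ℝ) (σD ν R : ℝ) (σ : ℝ → ℝ) : ℝ :=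
  ∫ x in (0:ℝ)..1, x ^ 2 * Sfun g σD ν (σ (R * x))

lemma scaled_monoOn {f : ℝ → ℝ} {β σD σbar R : ℝ} {σ σ' : ℝ → ℝ} (hF : GoodF f σD) (hR : 0 < R)
    (h : IsStationarySol f β σD σbar R σ σ') : MonotoneOn (fun x => σ (R * x)) (Icc 0 1) :=
  (scale_stat hR h).mono (hF.smul R)

lemma Gv_mono {f g : ℝ → ℝ} {β σD ν σbar R₁ R₂ : ℝ} {σ₁ σ₁' σ₂ σ₂' : ℝ → ℝ}
    (hF : GoodF f σD) (hβ : 0 < β) (hS : Monotone (Sfun g σD ν)) (hR₁ : 0 < R₁) (hR : R₁ ≤ R₂)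
    (h₁ : IsStationarySol f β σD σbar R₁ σ₁ σ₁') (h₂ : IsStationarySol f β σD σbar R₂ σ₂ σ₂') :
    Gv g σD ν R₂ σ₂ ≤ Gv g σD ν R₁ σ₁ := by
  apply intervalIntegral.integral_mono_on zero_le_one
    (intble_mono hS (scaled_monoOn hF (hR₁.trans_le hR) h₂))
    (intble_mono hS (scaled_monoOn hF hR₁ h₁))
  intro x hx
  exact mul_le_mul_of_nonneg_left (hS (scaled_mono hF hβ hR₁ hR h₁ h₂ hx)) (sq_nonneg x)

lemma Gv_scale {g : ℝ → ℝ} {σD ν R : ℝ} {σ : ℝ → ℝ} :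
    ∫ r in (0:ℝ)..R, Sfun g σD ν (σ r) * r ^ 2 = R ^ 3 * Gv g σD ν R σ := by
  have e2 := intervalIntegral.mul_integral_comp_mul_left (a := 0) (b := 1)
      (f := fun r => Sfun g σD ν (σ r) * r ^ 2) R
  rw [mul_zero, mul_one] at e2
  rw [← e2]
  unfold Gv
  rw [← intervalIntegral.integral_const_mul, ← intervalIntegral.integral_const_mul]
  congr 1; ext x; ring

lemma key2 {f g : ℝ → ℝ} {β σD ν σbar R₀ Rs : ℝ} (hF : GoodF f σD) (hfc : ContinuousOn f (Ici 0))
    (hfp : ∀ s > σD, 0 < f s) (hσD : 0 < σD) (hβ : 0 < β) (hb : σD < σbar)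
    (hS : Monotone (Sfun g σD ν)) (hS2 : StrictMonoOn (Sfun g σD ν) (Ici σD))
    (hR₀ : 0 < R₀) (hRs : 0 < Rs) {Rn : ℕ → ℝ} (hRn : ∀ n, 0 < Rn n)
    (hlim : Tendsto Rn atTop (𝓝 Rs)) {u₀ u₀' : ℝ → ℝ} {u u' : ℕ → ℝ → ℝ}
    (h₀ : IsStationarySol f β σD σbar R₀ u₀ u₀')
    (hn : ∀ n, IsStationarySol f β σD σbar (Rn n) (u n) (u' n))
    (hmono : (Antitone Rn ∧ ∀ n, R₀ ≤ Rn n) ∨ (Monotone Rn ∧ ∀ n, Rn n ≤ R₀))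
    (hG : Tendsto (fun n => Gv g σD ν (Rn n) (u n)) atTop (𝓝 (Gv g σD ν R₀ u₀))) : Rs = R₀ := by
  refine key_limit hF hfc hfp hσD hβ hb hR₀ hRs hRn hlim (scale_stat hR₀ h₀)
    (fun n => scale_stat (hRn n) (hn n)) ?_
  have i0 := (intble_mono hS (scaled_monoOn hF hR₀ h₀)).1
  have iN := fun n => (intble_mono hS (scaled_monoOn hF (hRn n) (hn n))).1
  unfold Gv at hG
  simp only [intervalIntegral.integral_of_le zero_le_one] at hG
  have key : ∀ᵐ x ∂(volume.restrict (Ioc (0:ℝ) 1)),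
      Tendsto (fun n => x ^ 2 * Sfun g σD ν (u n (Rn n * x))) atTop
        (𝓝 (x ^ 2 * Sfun g σD ν (u₀ (R₀ * x)))) := by
    rcases hmono with ⟨h1, h2⟩ | ⟨h1, h2⟩
    · apply tendsto_of_integral_tendsto_of_monotone iN i0 hG
      · rw [ae_restrict_iff' measurableSet_Ioc]
        refine Eventually.of_forall fun x hx n m hnm => ?_
        exact mul_le_mul_of_nonneg_left (hS (scaled_mono hF hβ (hRn m) (h1 hnm) (hn m) (hn n)
          ⟨hx.1.le, hx.2⟩)) (sq_nonneg x)
      · rw [ae_restrict_iff' measurableSet_Ioc]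
        refine Eventually.of_forall fun x hx n => ?_
        exact mul_le_mul_of_nonneg_left (hS (scaled_mono hF hβ hR₀ (h2 n) h₀ (hn n)
          ⟨hx.1.le, hx.2⟩)) (sq_nonneg x)
    · apply tendsto_of_integral_tendsto_of_antitone iN i0 hG
      · rw [ae_restrict_iff' measurableSet_Ioc]
        refine Eventually.of_forall fun x hx n m hnm => ?_
        exact mul_le_mul_of_nonneg_left (hS (scaled_mono hF hβ (hRn n) (h1 hnm) (hn n) (hn m)
          ⟨hx.1.le, hx.2⟩)) (sq_nonneg x)
      · rw [ae_restrict_iff' measurableSet_Ioc]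
        refine Eventually.of_forall fun x hx n => ?_
        exact mul_le_mul_of_nonneg_left (hS (scaled_mono hF hβ (hRn n) (h2 n) (hn n) h₀
          ⟨hx.1.le, hx.2⟩)) (sq_nonneg x)
  rw [ae_restrict_iff' measurableSet_Ioc] at key
  filter_upwards [key] with x hx hxI
  have hxc : x ∈ Icc (0:ℝ) 1 := ⟨hxI.1.le, hxI.2.le⟩
  have hp : x ^ 2 ≠ 0 := (pow_pos hxI.1 2).ne'
  have h3 := (hx ⟨hxI.1, hxI.2.le⟩).const_mul (x ^ 2)⁻¹
  simp only [inv_mul_cancel_left₀ hp] at h3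
  exact tendsto_of_S hS2
    (fun n => (scale_stat (hRn n) (hn n)).ge_D (hF.smul _) (mul_pos hβ (hRn n)) one_pos hb hxc)
    ((scale_stat hR₀ h₀).ge_D (hF.smul _) (mul_pos hβ hR₀) one_pos hb hxc) h3

lemma ae_translate {k : ℝ → ℝ} (hm : Measurable k) (hk : IntegrableOn k (Ioi 0)) {ω : ℝ}
    (hω : 0 < ω) : ∀ᵐ t, t ∈ Ioo 0 ω → Tendsto (fun n : ℕ => k (t + n * ω)) atTop (𝓝 0) := by
  have hme : Measurable (fun x => ‖k x‖ₑ) := hm.enorm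
  have hmeas : ∀ n : ℕ, Measurable (fun x => ‖k (x + n * ω)‖ₑ) :=
    fun n => hme.comp (measurable_add_const _)
  have hsh : ∀ n : ℕ, ∫⁻ x in Ioc 0 ω, ‖k (x + n * ω)‖ₑ =
      ∫⁻ x in Ioc ((n : ℝ) * ω) (((n + 1 : ℕ) : ℝ) * ω), ‖k x‖ₑ := by
    intro n
    have := (measurePreserving_add_right volume ((n:ℝ) * ω)).setLIntegral_comp_preimage_emb
      (measurableEmbedding_addRight _) (fun x => ‖k x‖ₑ)
      (Ioc ((n : ℝ) * ω) (((n + 1 : ℕ) : ℝ) * ω))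
    rw [← this, Set.preimage_add_const_Ioc]
    congr 3
    · ring
    · push_cast; ring
  have hmon : Monotone (fun n : ℕ => (n : ℝ) * ω) := fun a b hab => by
    have : (a : ℝ) ≤ b := by exact_mod_cast hab
    exact mul_le_mul_of_nonneg_right this hω.le
  have hsum : ∫⁻ x in Ioc 0 ω, ∑' n : ℕ, ‖k (x + n * ω)‖ₑ ≠ ⊤ := by
    rw [lintegral_tsum (fun n => (hmeas n).aemeasurable)]
    simp_rw [hsh]
    rw [← lintegral_iUnion (fun n => measurableSet_Ioc)
      (by simpa using hmon.pairwise_disjoint_on_Ioc_succ)]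
    refine ne_top_of_le_ne_top hk.2.ne (lintegral_mono_set ?_)
    refine iUnion_subset fun n x hx => ?_
    exact lt_of_le_of_lt (by positivity) hx.1
  have := ae_lt_top (Measurable.ennreal_tsum hmeas) hsum
  rw [ae_restrict_iff' measurableSet_Ioc] at this
  filter_upwards [this] with t ht htI
  have h1 := ENNReal.tendsto_atTop_zero_of_tsum_ne_top (ht ⟨htI.1, htI.2.le⟩).ne
  rw [tendsto_zero_iff_norm_tendsto_zero]
  have h2 := (ENNReal.tendsto_toReal ENNReal.zero_ne_top).comp h1
  simpa [Function.comp_def] using h2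

lemma IsEvolutionSol.logDeriv {f g : ℝ → ℝ} {β σD ν : ℝ} {φ : ℝ → ℝ} {σ : ℝ → ℝ → ℝ}
    {R R' : ℝ → ℝ} (h : IsEvolutionSol f g β σD ν φ σ R R') {t : ℝ} (ht : 0 < t) :
    HasDerivAt (fun s => Real.log (R s)) (Gv g σD ν (R t) (fun r => σ r t)) t := by
  have h1 := (h.deriv t ht.le).hasDerivAt (Ici_mem_nhds ht)
  have hp := h.pos t ht.le
  have h2 := h1.log hp.ne'
  have h3 := h.ode t ht
  rw [Gv_scale (σ := fun r => σ r t)] at h3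
  convert h2 using 1
  rw [eq_div_iff hp.ne']
  apply mul_left_cancel₀ (pow_pos hp 2).ne'
  rw [h3]; ring

lemma IsEvolutionSol.contR {f g : ℝ → ℝ} {β σD ν : ℝ} {φ : ℝ → ℝ} {σ : ℝ → ℝ → ℝ}
    {R R' : ℝ → ℝ} (h : IsEvolutionSol f g β σD ν φ σ R R') : ContinuousOn R (Ici 0) :=
  fun t ht => (h.deriv t ht).continuousWithinAt

lemma per_nat {Q : ℝ → ℝ} {ω : ℝ} (hω : 0 < ω) (h : ∀ t ≥ (0:ℝ), Q (t + ω) = Q t) (n : ℕ) :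
    ∀ t ≥ (0:ℝ), Q (t + n * ω) = Q t := by
  induction n with
  | zero => simp
  | succ n ih =>
    intro t ht
    have := h (t + n * ω) (by positivity)
    rw [← ih t ht, ← this]; congr 1; push_cast; ring

lemma per_bdd {Q : ℝ → ℝ} {ω : ℝ} (hω : 0 < ω) (h : ∀ t ≥ (0:ℝ), Q (t + ω) = Q t)
    (hc : ContinuousOn Q (Ici 0)) : ∃ M, ∀ t ≥ (0:ℝ), Q t ≤ M := by
  obtain ⟨M, hM⟩ := isCompact_Icc.bddAbove_image
    (hc.mono (show Icc 0 ω ⊆ Ici 0 from fun x hx => hx.1))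
  refine ⟨M, fun t ht => ?_⟩
  have h1 : 0 ≤ t / ω := by positivity
  have h2 := Nat.floor_le h1
  have h3 := Nat.lt_floor_add_one (t / ω)
  rw [le_div_iff₀ hω] at h2
  rw [div_lt_iff₀ hω] at h3
  have h4 := per_nat hω h ⌊t / ω⌋₊ (t - ⌊t / ω⌋₊ * ω) (by linarith)
  rw [sub_add_cancel] at h4
  rw [h4]
  exact hM ⟨_, ⟨by linarith, by linarith⟩, rfl⟩

lemma exists_large {g φ : ℝ → ℝ} {σD ν ω : ℝ} (hν : 0 < ν) (hω : 0 < ω)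
    (hSbar : 0 < (1 / ω) * ∫ t in (0:ℝ)..ω, Sfun g σD ν (φ t)) (hφ : Continuous φ) :
    (Ioo 0 ω ∩ {t | σD < φ t}).Nonempty := by
  by_contra hc
  rw [not_nonempty_iff_eq_empty] at hc
  have h1 : ∀ t ∈ Icc 0 ω, φ t ≤ σD := by
    have hcl : IsClosed {t | φ t ≤ σD} := isClosed_le hφ continuous_const
    have : closure (Ioo 0 ω) ⊆ {t | φ t ≤ σD} := by
      apply closure_minimal _ hcl
      intro t ht
      by_contra h2
      simp only [mem_setOf_eq, not_le] at h2
      exact (hc ▸ (⟨ht, h2⟩ : t ∈ Ioo 0 ω ∩ {t | σD < φ t}) : t ∈ (∅ : Set ℝ))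
    rwa [closure_Ioo hω.ne] at this
  have h2 : ∫ t in (0:ℝ)..ω, Sfun g σD ν (φ t) = ∫ t in (0:ℝ)..ω, -ν := by
    apply intervalIntegral.integral_congr
    intro t ht
    rw [uIcc_of_le hω.le] at ht
    simp [Sfun, not_lt.2 (h1 t ht)]
  rw [h2] at hSbar
  simp at hSbar
  rw [← mul_assoc, inv_mul_cancel₀ hω.ne'] at hSbar
  linarith

lemma main_conv (β σD ν ω : ℝ) (hβ : 0 < β) (hσD : 0 < σD) (hν : 0 < ν) (hω : 0 < ω)
    (f g : ℝ → ℝ) (hf : C1StrictInc f) (hf0 : f 0 = 0)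
    (hg : C1StrictInc g) (hgν : 0 ≤ g σD + ν)
    (φ : ℝ → ℝ) (hφc : Continuous φ)
    (hφper : Function.Periodic φ ω)
    (hSbar : 0 < (1 / ω) * ∫ t in (0:ℝ)..ω, Sfun g σD ν (φ t))
    (σp : ℝ → ℝ → ℝ) (Rp Rp' : ℝ → ℝ)
    (hp : IsEvolutionSol f g β σD ν φ σp Rp Rp')
    (hper : ∀ t ≥ (0:ℝ), Rp (t + ω) = Rp t)
    (σ : ℝ → ℝ → ℝ) (R R' : ℝ → ℝ) (h : IsEvolutionSol f g β σD ν φ σ R R') :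
    Tendsto (fun t => |R t - Rp t|) atTop (nhds 0) := by
  obtain ⟨hF, hfp⟩ := goodF_of hσD hf hf0
  obtain ⟨hS, hS2⟩ := Sfun_mono hσD hg hgν
  have hfc : ContinuousOn f (Ici 0) := hf.1.continuousOn
  set D : ℝ → ℝ := fun t => Real.log (R t) - Real.log (Rp t) with hD
  set G₁ : ℝ → ℝ := fun t => Gv g σD ν (R t) (fun r => σ r t) with hG₁
  set G₂ : ℝ → ℝ := fun t => Gv g σD ν (Rp t) (fun r => σp r t) with hG₂
  have hRD : ∀ t ≥ (0:ℝ), R t = Rp t * Real.exp (D t) := fun t ht => by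
    simp only [hD]
    rw [Real.exp_sub, Real.exp_log (h.pos t ht), Real.exp_log (hp.pos t ht)]
    have := hp.pos t ht
    field_simp
  have hDd : ∀ t > 0, HasDerivAt D (G₁ t - G₂ t) t := fun t ht =>
    (h.logDeriv ht).sub (hp.logDeriv ht)
  have hDc : ContinuousOn D (Ici 0) :=
    (h.contR.log fun t ht => (h.pos t ht).ne').sub (hp.contR.log fun t ht => (hp.pos t ht).ne')
  have hsgn : ∀ t ≥ 0, D t * (G₁ t - G₂ t) ≤ 0 := by
    intro t ht
    obtain ⟨s1, hs1⟩ := h.stat t ht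
    obtain ⟨s2, hs2⟩ := hp.stat t ht
    rcases le_total (Rp t) (R t) with hc | hc
    · have h1 : 0 ≤ D t := sub_nonneg.2 (Real.log_le_log (hp.pos t ht) hc)
      have h2 : G₁ t ≤ G₂ t := Gv_mono hF hβ hS (hp.pos t ht) hc hs2 hs1
      exact mul_nonpos_of_nonneg_of_nonpos h1 (by linarith)
    · have h1 : D t ≤ 0 := sub_nonpos.2 (Real.log_le_log (h.pos t ht) hc)
      have h2 : G₂ t ≤ G₁ t := Gv_mono hF hβ hS (h.pos t ht) hc hs1 hs2
      exact mul_nonpos_of_nonpos_of_nonneg h1 (by linarith)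
  set E : ℝ → ℝ := fun t => D t ^ 2 with hE
  have hEd : ∀ t > 0, HasDerivAt E (2 * (D t * (G₁ t - G₂ t))) t := fun t ht => by
    refine ((hDd t ht).pow 2).congr_deriv ?_
    norm_num
    ring
  have hEc : ContinuousOn E (Ici 0) := hDc.pow 2
  have hEanti : AntitoneOn E (Ici 0) := by
    apply antitoneOn_of_deriv_nonpos (convex_Ici 0) hEc
    · rw [interior_Ici]; exact fun t ht => (hEd t ht).differentiableAt.differentiableWithinAt
    · rw [interior_Ici]; intro t ht
      rw [(hEd t ht).deriv]
      linarith [hsgn t (le_of_lt ht)]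
  obtain ⟨e, he⟩ : ∃ e, Tendsto E atTop (𝓝 e) := by
    have ha : Antitone (fun t => E (max t 0)) := fun a b hab =>
      hEanti (show max a 0 ∈ Ici (0:ℝ) from mem_Ici.2 (le_max_right _ _))
        (show max b 0 ∈ Ici (0:ℝ) from mem_Ici.2 (le_max_right _ _)) (max_le_max hab le_rfl)
    have hb : BddBelow (range fun t => E (max t 0)) :=
      ⟨0, by rintro _ ⟨t, rfl⟩; exact sq_nonneg _⟩
    refine ⟨_, (tendsto_atTop_ciInf ha hb).congr' ?_⟩
    filter_upwards [eventually_ge_atTop 0] with t ht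
    rw [max_eq_left ht]
  have hele : ∀ t ≥ 0, e ≤ E t := fun t ht => by
    refine le_of_tendsto he ?_
    filter_upwards [eventually_ge_atTop t] with s hs
    exact hEanti ht (ht.trans hs) hs
  have he0 : 0 ≤ e := ge_of_tendsto' he (fun t => sq_nonneg _)
  rcases he0.eq_or_lt with hez | hepos
  · -- convergence
    rw [← hez] at he
    have hD0 : Tendsto D atTop (𝓝 0) := by
      have := (Real.continuous_sqrt.tendsto 0).comp he
      rw [tendsto_zero_iff_abs_tendsto_zero]
      simpa [Function.comp_def, hE, Real.sqrt_sq_eq_abs] using this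
    obtain ⟨M, hM⟩ := per_bdd hω hper hp.contR
    have h1 : Tendsto (fun t => M * |Real.exp (D t) - 1|) atTop (𝓝 0) := by
      have : Tendsto (fun t => M * |Real.exp (D t) - 1|) atTop (𝓝 (M * |Real.exp 0 - 1|)) :=
        ((((Real.continuous_exp.tendsto 0).comp hD0).sub_const 1).abs).const_mul M
      simpa using this
    refine squeeze_zero' (Eventually.of_forall fun t => abs_nonneg _) ?_ h1
    filter_upwards [eventually_ge_atTop 0] with t ht
    have h2 : R t - Rp t = Rp t * (Real.exp (D t) - 1) := by rw [hRD t ht]; ring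
    rw [h2, abs_mul, abs_of_pos (hp.pos t ht)]
    exact mul_le_mul_of_nonneg_right (hM t ht) (abs_nonneg _)
  · exfalso
    have hint : IntegrableOn (deriv E) (Ioi 0) := by
      apply integrableOn_Ioi_deriv_of_nonpos (hEc 0 self_mem_Ici) _ _ he
      · intro t ht; exact (hEd t ht).differentiableAt.hasDerivAt
      · intro t ht
        rw [(hEd t ht).deriv]
        linarith [hsgn t (le_of_lt ht)]
    have hae := ae_translate (measurable_deriv E) hint hω
    obtain ⟨t, ⟨htI, htφ⟩, htl⟩ := ae_exists_mem hae
      (isOpen_Ioo.inter (isOpen_lt continuous_const hφc)) (exists_large hν hω hSbar hφc)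
    have htl := htl htI
    simp only [mem_setOf_eq] at htφ
    have htn : ∀ n : ℕ, 0 < t + n * ω := fun n => by have := htI.1; positivity
    have htn' : ∀ n : ℕ, 0 ≤ t + n * ω := fun n => (htn n).le
    have hφn : ∀ n : ℕ, φ (t + n * ω) = φ t := fun n => hφper.nat_mul n t
    have hRpn : ∀ n : ℕ, Rp (t + n * ω) = Rp t := fun n => per_nat hω hper n t htI.1.le
    obtain ⟨s0, hs0⟩ := hp.stat t htI.1.le
    have hG2n : ∀ n : ℕ, G₂ (t + n * ω) = G₂ t := by
      intro n
      obtain ⟨s1, hs1⟩ := hp.stat (t + n * ω) (htn' n)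
      rw [hφn n] at hs1
      exact le_antisymm (Gv_mono hF hβ hS (hp.pos t htI.1.le) (hRpn n).ge hs0 hs1)
        (Gv_mono hF hβ hS (hp.pos _ (htn' n)) (hRpn n).le hs1 hs0)
    have hsq : ∀ s ≥ 0, √e ≤ |D s| := fun s hs => by
      rw [← Real.sqrt_sq_eq_abs]; exact Real.sqrt_le_sqrt (hele s hs)
    have hsqe : 0 < √e := Real.sqrt_pos.2 hepos
    have hGdiff : Tendsto (fun n : ℕ => G₁ (t + n * ω) - G₂ t) atTop (𝓝 0) := by
      rw [tendsto_zero_iff_abs_tendsto_zero]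
      have hup := (htl.abs).div_const (2 * √e)
      rw [abs_zero, zero_div] at hup
      refine squeeze_zero (fun n => abs_nonneg _) (fun n => ?_) hup
      rw [(hEd _ (htn n)).deriv, hG2n n, abs_mul, abs_mul, abs_two]
      simp only [Function.comp]
      rw [le_div_iff₀ (by positivity)]
      have := mul_le_mul_of_nonneg_right (hsq _ (htn' n)) (abs_nonneg (G₁ (t + n * ω) - G₂ t))
      linarith
    have hGl : Tendsto (fun n : ℕ => G₁ (t + n * ω)) atTop (𝓝 (G₂ t)) := by
      simpa using hGdiff.add_const (G₂ t)
    have hne : ∀ s ≥ 0, D s ≠ 0 := fun s hs h0 => by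
      have := hsq s hs
      rw [h0, abs_zero] at this; linarith
    have htT : Tendsto (fun n : ℕ => t + n * ω) atTop atTop :=
      tendsto_atTop_add_const_left _ _ (tendsto_natCast_atTop_atTop.atTop_mul_const hω)
    have hElim : Tendsto (fun n : ℕ => √(E (t + n * ω))) atTop (𝓝 (√e)) :=
      (Real.continuous_sqrt.tendsto e).comp (he.comp htT)
    have hEan : Antitone (fun n : ℕ => √(E (t + n * ω))) := fun a b hab => by
      apply Real.sqrt_le_sqrt
      apply hEanti (htn' a) (htn' b)
      have : (a : ℝ) ≤ b := by exact_mod_cast hab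
      nlinarith
    choose s hs using fun n : ℕ => h.stat (t + n * ω) (htn' n)
    simp only [hφn] at hs
    have hRpt := hp.pos t htI.1.le
    have hsign : (∀ s ≥ 0, 0 < D s) ∨ (∀ s ≥ 0, D s < 0) := by
      by_contra hcon
      push Not at hcon
      obtain ⟨⟨a, ha, ha2⟩, b, hb, hb2⟩ := hcon
      obtain ⟨c, hc, hc2⟩ := isPreconnected_Ici.intermediate_value (show a ∈ Ici (0:ℝ) from ha)
        (show b ∈ Ici (0:ℝ) from hb) hDc ⟨ha2, hb2⟩
      exact hne c hc hc2
    have hRn : ∀ n : ℕ, 0 < R (t + n * ω) := fun n => h.pos _ (htn' n)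
    rcases hsign with hpos | hneg
    · have hDe : ∀ n : ℕ, R (t + n * ω) = Rp t * Real.exp (√(E (t + n * ω))) := fun n => by
        rw [hRD _ (htn' n), hRpn n]
        simp only [hE]
        rw [Real.sqrt_sq (hpos _ (htn' n)).le]
      have hl : Tendsto (fun n : ℕ => R (t + n * ω)) atTop (𝓝 (Rp t * Real.exp (√e))) := by
        simp only [hDe]
        exact ((Real.continuous_exp.tendsto _).comp hElim).const_mul _
      have := key2 hF hfc hfp hσD hβ htφ hS hS2 hRpt (by positivity) hRn hl hs0 hs
        (Or.inl ⟨fun a b hab => by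
          simp only [hDe]
          exact mul_le_mul_of_nonneg_left (Real.exp_le_exp.2 (hEan hab)) hRpt.le, fun n => by
          simp only [hDe]
          exact le_mul_of_one_le_right hRpt.le (Real.one_le_exp (Real.sqrt_nonneg _))⟩) hGl
      have h1 : 1 < Real.exp (√e) := Real.one_lt_exp_iff.2 hsqe
      nlinarith
    · have hDe : ∀ n : ℕ, R (t + n * ω) = Rp t * Real.exp (-√(E (t + n * ω))) := fun n => by
        rw [hRD _ (htn' n), hRpn n]
        simp only [hE]
        rw [Real.sqrt_sq_eq_abs, abs_of_neg (hneg _ (htn' n)), neg_neg]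
      have hl : Tendsto (fun n : ℕ => R (t + n * ω)) atTop (𝓝 (Rp t * Real.exp (-√e))) := by
        simp only [hDe]
        exact ((Real.continuous_exp.tendsto _).comp hElim.neg).const_mul _
      have := key2 hF hfc hfp hσD hβ htφ hS hS2 hRpt (by positivity) hRn hl hs0 hs
        (Or.inr ⟨fun a b hab => by
          simp only [hDe]
          exact mul_le_mul_of_nonneg_left (Real.exp_le_exp.2 (neg_le_neg (hEan hab))) hRpt.le,
          fun n => by
          simp only [hDe]
          exact mul_le_of_le_one_right hRpt.le (Real.exp_le_one_iff.2
            (neg_nonpos.2 (Real.sqrt_nonneg _)))⟩) hGl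
      have h1 : Real.exp (-√e) < 1 := by
        rw [← Real.exp_zero]; exact Real.exp_lt_exp.2 (by linarith)
      nlinarith


/-- If (A1)–(A3) hold and $\bar S > 0$, then any positive $ω$-periodic solution
attracts every solution of the evolutionary tumor problem:
$\lim_{t→∞}|R(t) − R_{per}(t)| = 0$; in particular any two positive $ω$-periodic
solutions have identical radius components. -/
theorem stmt_3 (β σD ν ω : ℝ) (hβ : 0 < β) (hσD : 0 < σD) (hν : 0 < ν) (hω : 0 < ω)
    (f g : ℝ → ℝ) (hf : C1StrictInc f) (hf0 : f 0 = 0)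
    (hg : C1StrictInc g) (hgz : ∃ σt > σD, g σt = 0) (hgν : 0 ≤ g σD + ν)
    (φ : ℝ → ℝ) (hφc : Continuous φ) (hφpos : ∀ t, 0 < φ t)
    (hφper : Function.Periodic φ ω)
    (hSbar : 0 < (1 / ω) * ∫ t in (0:ℝ)..ω, Sfun g σD ν (φ t))
    (σper : ℝ → ℝ → ℝ) (Rper Rper' : ℝ → ℝ)
    (hper : IsEvolutionSol f g β σD ν φ σper Rper Rper')
    (hperiodic : ∀ t ≥ (0:ℝ), Rper (t + ω) = Rper t) :
    (∀ (σ : ℝ → ℝ → ℝ) (R R' : ℝ → ℝ), IsEvolutionSol f g β σD ν φ σ R R' →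
      0 < R 0 → Tendsto (fun t => |R t - Rper t|) atTop (nhds 0)) ∧
    (∀ (σ₁ : ℝ → ℝ → ℝ) (R₁ R₁' : ℝ → ℝ) (σ₂ : ℝ → ℝ → ℝ) (R₂ R₂' : ℝ → ℝ),
      IsEvolutionSol f g β σD ν φ σ₁ R₁ R₁' → (∀ t ≥ (0:ℝ), R₁ (t + ω) = R₁ t) →
      IsEvolutionSol f g β σD ν φ σ₂ R₂ R₂' → (∀ t ≥ (0:ℝ), R₂ (t + ω) = R₂ t) →
      ∀ t ≥ (0:ℝ), R₁ t = R₂ t) := by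
  have main := main_conv β σD ν ω hβ hσD hν hω f g hf hf0 hg hgν φ hφc hφper hSbar
  refine ⟨fun σ R R' h _ => main σper Rper Rper' hper hperiodic σ R R' h, ?_⟩
  intro σ₁ R₁ R₁' σ₂ R₂ R₂' h₁ hp₁ h₂ hp₂ t ht
  have hl := main σ₂ R₂ R₂' h₂ hp₂ σ₁ R₁ R₁' h₁
  have htT : Tendsto (fun n : ℕ => t + n * ω) atTop atTop :=
    tendsto_atTop_add_const_left _ _ (tendsto_natCast_atTop_atTop.atTop_mul_const hω)
  have h3 := hl.comp htT
  have h4 : (fun t => |R₁ t - R₂ t|) ∘ (fun n : ℕ => t + n * ω) = fun _ => |R₁ t - R₂ t| := by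
    ext n
    simp only [Function.comp]
    rw [per_nat hω hp₁ n t ht, per_nat hω hp₂ n t ht]
  rw [h4] at h3
  have h5 := tendsto_nhds_unique h3 tendsto_const_nhds
  exact sub_eq_zero.1 (abs_eq_zero.1 h5.symm)
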